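/- Let 1 < q < α < p < γ be real numbers and T, Q, F > 0. Define Λⁿ(t) = ((p−α)·t^p·T − (γ−α)·t^γ·F)/((α−q)·t^q·Q) and Λ^e(t) = q·((p−α)·t^p·T/p − (γ−α)·t^γ·F/γ)/((α−q)·t^q·Q), and let t^e = (C_e·T/F)^{1/(γ−p)} with C_e = γ(p−α)(p−q)/(p(γ−α)(γ−q)) be the global maximum point of Λ^e. Then for every λ with 0 < λ < sup_{t>0} Λ^e(t): the equation Λⁿ(t) = λ has exactly two solutions t^{n,+} < t^{n,−} in (0,∞), the equation Λ^e(t) = λ has exactly two solutions t^{e,+} < t^{e,−} in (0,∞), and these satisfy the strict ordering t^{n,+} < t^{e,+} < t^e < t^{n,−} < t^{e,−}. -/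

import Mathlib

lemma aux_mono (A B a b m : ℝ) (hA : 0 < A) (hB : 0 < B) (ha : 0 < a) (hab : a < b)
    (hm : 0 < m) (hmm : m ^ (b - a) = a * A / (b * B)) :
    StrictMonoOn (fun t : ℝ => A * t ^ a - B * t ^ b) (Set.Icc 0 m) ∧
    StrictAntiOn (fun t : ℝ => A * t ^ a - B * t ^ b) (Set.Ici m) ∧
    Continuous (fun t : ℝ => A * t ^ a - B * t ^ b) := by
  have hb : 0 < b := ha.trans hab
  have hc : Continuous (fun t : ℝ => A * t ^ a - B * t ^ b) :=
    (continuous_const.mul (Real.continuous_rpow_const ha.le)).sub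
      (continuous_const.mul (Real.continuous_rpow_const hb.le))
  have hd : ∀ t : ℝ, 0 < t → deriv (fun t : ℝ => A * t ^ a - B * t ^ b) t
      = t ^ (a - 1) * (a * A - b * B * t ^ (b - a)) := by
    intro t ht
    have h1 := ((Real.hasDerivAt_rpow_const (x := t) (p := a) (Or.inl ht.ne')).const_mul A).sub
      ((Real.hasDerivAt_rpow_const (x := t) (p := b) (Or.inl ht.ne')).const_mul B)
    have h2 : t ^ (b - 1) = t ^ (a - 1) * t ^ (b - a) := by
      rw [← Real.rpow_add ht]; congr 1; ring
    refine h1.deriv.trans ?_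
    rw [h2]; ring
  have hbB : 0 < b * B := mul_pos hb hB
  have hmm' : b * B * m ^ (b - a) = a * A := by
    rw [hmm]; field_simp
  refine ⟨?_, ?_, hc⟩
  · apply strictMonoOn_of_deriv_pos (convex_Icc 0 m) hc.continuousOn
    intro t ht
    rw [interior_Icc] at ht
    rw [hd t ht.1]
    apply mul_pos (Real.rpow_pos_of_pos ht.1 _)
    have := Real.rpow_lt_rpow ht.1.le ht.2 (sub_pos.2 hab)
    have := mul_lt_mul_of_pos_left this hbB
    linarith
  · apply strictAntiOn_of_deriv_neg (convex_Ici m) hc.continuousOn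
    intro t ht
    rw [interior_Ici] at ht
    have ht' : m < t := ht
    have ht0 : 0 < t := hm.trans ht'
    rw [hd t ht0]
    apply mul_neg_of_pos_of_neg (Real.rpow_pos_of_pos ht0 _)
    have := Real.rpow_lt_rpow hm.le ht' (sub_pos.2 hab)
    have := mul_lt_mul_of_pos_left this hbB
    linarith

lemma aux_max (A B a b m : ℝ) (hA : 0 < A) (hB : 0 < B) (ha : 0 < a) (hab : a < b)
    (hm : 0 < m) (hmm : m ^ (b - a) = a * A / (b * B)) (t : ℝ) (ht : 0 < t) :
    A * t ^ a - B * t ^ b ≤ A * m ^ a - B * m ^ b := by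
  obtain ⟨h1, h2, -⟩ := aux_mono A B a b m hA hB ha hab hm hmm
  rcases le_total t m with h | h
  · exact h1.monotoneOn ⟨ht.le, h⟩ ⟨hm.le, le_rfl⟩ h
  · exact h2.antitoneOn (Set.mem_Ici.2 le_rfl) h h

lemma aux_two (A B a b : ℝ) (hA : 0 < A) (hB : 0 < B) (ha : 0 < a) (hab : a < b)
    (f : ℝ → ℝ) (hf : ∀ t, 0 < t → f t = A * t ^ a - B * t ^ b)
    (lam s : ℝ) (hl : 0 < lam) (hs : 0 < s) (hfs : lam < f s) :
    ∃ x y : ℝ, 0 < x ∧ x < y ∧ f x = lam ∧ f y = lam ∧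
      (∀ t, 0 < t → f t = lam → t = x ∨ t = y) ∧
      (∀ t, 0 < t → lam < f t → x < t ∧ t < y) := by
  have hb : 0 < b := ha.trans hab
  have hba : 0 < b - a := sub_pos.2 hab
  obtain ⟨m, hm, hmm⟩ : ∃ m : ℝ, 0 < m ∧ m ^ (b - a) = a * A / (b * B) := by
    have h0 : 0 < a * A / (b * B) := by positivity
    refine ⟨(a * A / (b * B)) ^ (b - a)⁻¹, Real.rpow_pos_of_pos h0 _, ?_⟩
    exact Real.rpow_inv_rpow h0.le hba.ne'
  obtain ⟨M, hM, hMM⟩ : ∃ M : ℝ, 0 < M ∧ M ^ (b - a) = A / B := by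
    have h0 : 0 < A / B := by positivity
    refine ⟨(A / B) ^ (b - a)⁻¹, Real.rpow_pos_of_pos h0 _, ?_⟩
    exact Real.rpow_inv_rpow h0.le hba.ne'
  have hmax := aux_max A B a b m hA hB ha hab hm hmm s hs
  obtain ⟨h1, h2, hc⟩ := aux_mono A B a b m hA hB ha hab hm hmm
  rw [hf s hs] at hfs
  set g : ℝ → ℝ := fun t : ℝ => A * t ^ a - B * t ^ b with hg
  have hgm : lam < g m := lt_of_lt_of_le hfs hmax
  have hg0 : g 0 = 0 := by
    simp [hg, Real.zero_rpow ha.ne', Real.zero_rpow hb.ne']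
  have hgM : g M = 0 := by
    have : M ^ b = M ^ a * M ^ (b - a) := by
      rw [← Real.rpow_add hM]; congr 1; ring
    simp only [hg]
    rw [this, hMM]; field_simp; ring
  have hmM : m < M := by
    by_contra! h
    have := h1 ⟨le_rfl, hm.le⟩ ⟨hM.le, h⟩ hM
    linarith
  obtain ⟨x, hx, hxl⟩ := intermediate_value_Icc hm.le hc.continuousOn
    (show lam ∈ Set.Icc (g 0) (g m) from ⟨by linarith, hgm.le⟩)
  obtain ⟨y, hy, hyl⟩ := intermediate_value_Icc' hmM.le hc.continuousOn
    (show lam ∈ Set.Icc (g M) (g m) from ⟨by linarith, hgm.le⟩)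
  have hx0 : 0 < x := lt_of_le_of_ne hx.1 (by rintro rfl; linarith)
  have hxm : x < m := lt_of_le_of_ne hx.2 (by rintro rfl; linarith)
  have hym : m < y := lt_of_le_of_ne hy.1 (by rintro rfl; linarith)
  refine ⟨x, y, hx0, hxm.trans hym, (hf x hx0).trans hxl,
    (hf y (hm.trans hym)).trans hyl, ?_, ?_⟩
  · intro t ht htl
    rw [hf t ht] at htl
    rcases le_total t m with h | h
    · left
      exact h1.injOn ⟨ht.le, h⟩ hx (htl.trans hxl.symm)
    · right
      exact h2.injOn h hym.le (htl.trans hyl.symm)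
  · intro t ht htl
    rw [hf t ht] at htl
    rcases le_total t m with h | h
    · refine ⟨(h1.lt_iff_lt hx ⟨ht.le, h⟩).1 ?_, h.trans_lt hym⟩
      rw [hxl]; exact htl
    · refine ⟨hxm.trans_le h, (h2.lt_iff_gt hym.le h).1 ?_⟩
      rw [hyl]; exact htl

/-- Item (iii) of Lemma 4.4: for `0 < λ < sup_{t>0} Λ^e(t)`, each of the equations
`Λⁿ(t) = λ` and `Λ^e(t) = λ` has exactly two solutions in `(0,∞)`, and they are strictly
ordered as `t^{n,+} < t^{e,+} < t^e < t^{n,−} < t^{e,−}`. -/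
theorem stmt_15 (q α p γ T Q F : ℝ)
    (hq : 1 < q) (hqα : q < α) (hαp : α < p) (hpγ : p < γ)
    (hT : 0 < T) (hQ : 0 < Q) (hF : 0 < F)
    (Λn Λe : ℝ → ℝ)
    (hΛn : Λn = fun t : ℝ =>
      ((p - α) * t ^ p * T - (γ - α) * t ^ γ * F) / ((α - q) * t ^ q * Q))
    (hΛe : Λe = fun t : ℝ =>
      q * ((p - α) * t ^ p * T / p - (γ - α) * t ^ γ * F / γ) / ((α - q) * t ^ q * Q))
    (Ce te : ℝ)
    (hCe : Ce = γ * (p - α) * (p - q) / (p * (γ - α) * (γ - q)))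
    (hte : te = (Ce * T / F) ^ (1 / (γ - p)))
    (lam : ℝ) (hlam0 : 0 < lam)
    (hlam : lam < ⨆ t : Set.Ioi (0 : ℝ), Λe (t : ℝ)) :
    ∃ tnp tnm tep tem : ℝ,
      0 < tnp ∧ tnp < tnm ∧ Λn tnp = lam ∧ Λn tnm = lam ∧
      (∀ t : ℝ, 0 < t → Λn t = lam → t = tnp ∨ t = tnm) ∧
      0 < tep ∧ tep < tem ∧ Λe tep = lam ∧ Λe tem = lam ∧
      (∀ t : ℝ, 0 < t → Λe t = lam → t = tep ∨ t = tem) ∧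
      tnp < tep ∧ tep < te ∧ te < tnm ∧ tnm < tem := by
  have hp : 0 < p := by linarith
  have hγ : 0 < γ := by linarith
  have hq0 : 0 < q := by linarith
  have e1 : 0 < α - q := by linarith
  have e2 : 0 < p - α := by linarith
  have e3 : 0 < γ - α := by linarith
  have e4 : 0 < p - q := by linarith
  have e5 : 0 < γ - q := by linarith
  have e6 : 0 < γ - p := by linarith
  obtain ⟨A, hA⟩ : ∃ A, A = (p - α) * T / ((α - q) * Q) := ⟨_, rfl⟩
  obtain ⟨B, hB⟩ : ∃ B, B = (γ - α) * F / ((α - q) * Q) := ⟨_, rfl⟩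
  have hA0 : 0 < A := by rw [hA]; positivity
  have hB0 : 0 < B := by rw [hB]; positivity
  have hn : ∀ t, 0 < t → Λn t = A * t ^ (p - q) - B * t ^ (γ - q) := by
    intro t ht
    have := Real.rpow_pos_of_pos ht q
    rw [hΛn, hA, hB, Real.rpow_sub ht, Real.rpow_sub ht]
    field_simp
  have he : ∀ t, 0 < t → Λe t = (q / p * A) * t ^ (p - q) - (q / γ * B) * t ^ (γ - q) := by
    intro t ht
    have := Real.rpow_pos_of_pos ht q
    rw [hΛe, hA, hB, Real.rpow_sub ht, Real.rpow_sub ht]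
    field_simp
  have hC0 : 0 < Ce * T / F := by rw [hCe]; positivity
  have hte0 : 0 < te := by rw [hte]; exact Real.rpow_pos_of_pos hC0 _
  have htp : te ^ (γ - p) = Ce * T / F := by
    rw [hte, one_div]; exact Real.rpow_inv_rpow hC0.le e6.ne'
  have hab : p - q < γ - q := by linarith
  have hsub : γ - q - (p - q) = γ - p := by ring
  have hmm : te ^ (γ - q - (p - q)) = (p - q) * (q / p * A) / ((γ - q) * (q / γ * B)) := by
    rw [hsub, htp, hCe, hA, hB]
    field_simp
  have hkey : (1 - q / γ) * B * te ^ (γ - p) = (1 - q / p) * A := by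
    rw [htp, hCe, hA, hB]
    field_simp
  have hdiff : ∀ t, 0 < t → Λn t - Λe t =
      t ^ (p - q) * ((1 - q / γ) * B * (te ^ (γ - p) - t ^ (γ - p))) := by
    intro t ht
    have h : t ^ (γ - q) = t ^ (p - q) * t ^ (γ - p) := by
      rw [← Real.rpow_add ht]; congr 1; ring
    rw [hn t ht, he t ht, mul_sub ((1 - q / γ) * B), hkey, h]
    ring
  have hcoef : 0 < (1 - q / γ) * B := by
    apply mul_pos _ hB0
    rw [sub_pos, div_lt_one hγ]; linarith
  have hA' : 0 < q / p * A := by positivity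
  have hB' : 0 < q / γ * B := by positivity
  haveI : Nonempty (Set.Ioi (0 : ℝ)) := ⟨⟨1, Set.mem_Ioi.2 one_pos⟩⟩
  obtain ⟨⟨s, hs⟩, hls⟩ := exists_lt_of_lt_ciSup hlam
  have hs : 0 < s := hs
  have hle : lam < Λe te := by
    refine lt_of_lt_of_le hls ?_
    show Λe s ≤ Λe te
    rw [he s hs, he te hte0]
    exact aux_max _ _ _ _ te hA' hB' e4 hab hte0 hmm s hs
  have hln : lam < Λn te := by
    have := hdiff te hte0
    simp at this
    linarith
  obtain ⟨x, y, hx0, hxy, hx, hy, hu, hb⟩ :=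
    aux_two A B _ _ hA0 hB0 e4 hab Λn hn lam te hlam0 hte0 hln
  obtain ⟨z, w, hz0, hzw, hz, hw, hu', hb'⟩ :=
    aux_two _ _ _ _ hA' hB' e4 hab Λe he lam te hlam0 hte0 hle
  obtain ⟨hzt, htw⟩ := hb' te hte0 hle
  obtain ⟨hxt, hty⟩ := hb te hte0 hln
  have hy0 : 0 < y := hx0.trans hxy
  refine ⟨x, y, z, w, hx0, hxy, hx, hy, hu, hz0, hzw, hz, hw, hu', ?_, hzt, hty, ?_⟩
  · refine (hb z hz0 ?_).1
    have h1 := Real.rpow_lt_rpow hz0.le hzt e6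
    have h2 := mul_pos (Real.rpow_pos_of_pos hz0 (p - q)) (mul_pos hcoef (sub_pos.2 h1))
    rw [← hdiff z hz0] at h2
    linarith
  · refine (hb' y hy0 ?_).2
    have h1 := Real.rpow_lt_rpow hte0.le hty e6
    have h2 := mul_neg_of_pos_of_neg (Real.rpow_pos_of_pos hy0 (p - q))
      (mul_neg_of_pos_of_neg hcoef (sub_neg.2 h1))
    rw [← hdiff y hy0] at h2
    linarith
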